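/- Let E be a finite free EI category. Then Ext^2_{kE}(kE_0, kE_0) = 0, where kE_0 = ⊕_{x ∈ Ob E} k Aut_E(x) is the degree-0 part of kE under the length grading. -/

import Mathlib

open CategoryTheory

namespace EICat

variable {E : Type} [Category E]

/-- A morphism is unfactorizable if it is not an isomorphism and in any factorization
one of the two factors is an isomorphism. -/
def Unfactorizable {x y : E} (f : x ⟶ y) : Prop :=
  ¬ IsIso f ∧ ∀ (z : E) (u : x ⟶ z) (v : z ⟶ y), u ≫ v = f → IsIso u ∨ IsIso v

/-- The composite of a chain of composable morphisms. -/
def compChain : (n : ℕ) → (obj : Fin (n + 1) → E) →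
    (mor : ∀ i : Fin n, obj i.castSucc ⟶ obj i.succ) → (obj 0 ⟶ obj (Fin.last n))
  | 0, _, _ => 𝟙 _
  | n + 1, obj, mor =>
      mor 0 ≫ compChain n (fun i => obj i.succ)
        (fun i => eqToHom (congrArg obj (Fin.succ_castSucc i)) ≫ mor i.succ)

/-- A decomposition of a morphism `f` into unfactorizable morphisms. -/
structure Decomp {x y : E} (f : x ⟶ y) where
  n : ℕ
  obj : Fin (n + 1) → E
  h0 : obj 0 = x
  hl : obj (Fin.last n) = y
  mor : ∀ i : Fin n, obj i.castSucc ⟶ obj i.succ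
  unfact : ∀ i, Unfactorizable (mor i)
  comp : compChain n obj mor = eqToHom h0 ≫ f ≫ eqToHom hl.symm

/-- The Unique Factorization Property: any two decompositions of a non-isomorphism into
unfactorizable morphisms have the same length, pass through the same objects, and
differ by automorphisms at the intermediate objects. -/
def HasUFP (E : Type) [Category E] : Prop :=
  ∀ {x y : E} (f : x ⟶ y), ¬ IsIso f →
    ∀ D D' : Decomp f,
      ∃ (hn : D.n = D'.n)
        (hobj : ∀ i : Fin (D.n + 1),
          D.obj i = D'.obj (Fin.cast (congrArg (· + 1) hn) i))
        (h : ∀ i : Fin (D.n + 1), D.obj i ⟶ D.obj i),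
        (∀ i, IsIso (h i)) ∧ h 0 = 𝟙 _ ∧ h (Fin.last D.n) = 𝟙 _ ∧
        ∀ i : Fin D.n,
          D.mor i ≫ h i.succ =
            h i.castSucc ≫ eqToHom (hobj i.castSucc) ≫
              eqToHom (congrArg D'.obj (by apply Fin.ext; rfl)) ≫
              D'.mor (Fin.cast hn i) ≫
              eqToHom (congrArg D'.obj (by apply Fin.ext; rfl) :
                D'.obj (Fin.cast hn i).succ
                  = D'.obj (Fin.cast (congrArg (· + 1) hn) i.succ)).symm ≫
              eqToHom (hobj i.succ).symm

/-- `E` is a finite free EI category. -/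
def IsFiniteFreeEI (E : Type) [Category E] : Prop :=
  Finite E ∧ (∀ x y : E, Finite (x ⟶ y)) ∧ (∀ (x : E) (f : x ⟶ x), IsIso f) ∧ HasUFP E

section Algebra

variable (k : Type) [Field k] (AA : Type) [Ring AA] [Algebra k AA]

open scoped Classical in
/-- `(AA, b)` is (a copy of) the category algebra `kE`: a `k`-algebra with basis the
morphisms of `E`, with convolution product and identity the sum of identities. -/
def IsCategoryAlgebra (b : (Σ x y : E, x ⟶ y) → AA) : Prop :=
  LinearIndependent k b ∧ Submodule.span k (Set.range b) = ⊤ ∧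
  (∀ (x y z w : E) (f : x ⟶ y) (g : z ⟶ w),
    b ⟨z, w, g⟩ * b ⟨x, y, f⟩ =
      if h : y = z then b ⟨x, w, f ≫ eqToHom h ≫ g⟩ else 0) ∧
  (1 : AA) = ∑ᶠ x : E, b ⟨x, x, 𝟙 x⟩

end Algebra

end EICat

namespace EICat

variable {E : Type} [Category E]

lemma compChain_cons {x : E} (n : ℕ) (obj : Fin (n + 1) → E)
    (mor : ∀ i : Fin n, obj i.castSucc ⟶ obj i.succ) (u : x ⟶ obj 0) :
    compChain (n + 1) (Fin.cons (α := fun _ => E) x obj)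
      (Fin.cases (motive := fun i => (Fin.cons (α := fun _ => E) x obj : Fin (n + 2) → E)
        i.castSucc ⟶ (Fin.cons (α := fun _ => E) x obj : Fin (n + 2) → E) i.succ) u mor) =
      u ≫ compChain n obj mor := by
  change u ≫ compChain n obj (fun i => 𝟙 _ ≫ mor i) = _
  simp only [Category.id_comp]

/-- Prepend an unfactorizable morphism to a decomposition. -/
def Decomp.cons {x y z : E} {u : x ⟶ y} (hu : Unfactorizable u) {w : y ⟶ z} (D : Decomp w) :
    Decomp (u ≫ w) := by
  obtain ⟨n, obj, rfl, rfl, mor, unf, comp⟩ := D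
  refine ⟨n + 1, Fin.cons (α := fun _ => E) x obj, rfl, rfl, Fin.cases u mor,
    Fin.cases hu unf, (compChain_cons n obj mor u).trans ?_⟩
  simp only [eqToHom_refl, Category.comp_id, Category.id_comp] at comp
  rw [comp]
  change _ = 𝟙 _ ≫ (u ≫ w) ≫ 𝟙 _
  simp

/-- The trivial decomposition of an identity. -/
def Decomp.id (x : E) : Decomp (𝟙 x) :=
  ⟨0, fun _ => x, rfl, rfl, fun i => i.elim0, fun i => i.elim0, by simp [compChain]⟩

/-- Morphisms of chains compose to a morphism between the composites. -/
lemma compChain_natural (n : ℕ) (obj : Fin (n + 1) → E)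
    (mor mor' : ∀ i : Fin n, obj i.castSucc ⟶ obj i.succ) (h : ∀ i, obj i ⟶ obj i)
    (hh : ∀ i : Fin n, mor i ≫ h i.succ = h i.castSucc ≫ mor' i) :
    compChain n obj mor ≫ h (Fin.last n) = h 0 ≫ compChain n obj mor' := by
  induction n with
  | zero => simp [compChain]
  | succ n ih =>
    have e := ih (fun i => obj i.succ)
      (fun i => eqToHom (congrArg obj (Fin.succ_castSucc i)) ≫ mor i.succ)
      (fun i => eqToHom (congrArg obj (Fin.succ_castSucc i)) ≫ mor' i.succ)
      (fun i => h i.succ) (fun i => by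
        have := hh i.succ
        simp only [Category.assoc, this]
        change 𝟙 _ ≫ h i.succ.castSucc ≫ mor' i.succ = h i.succ.castSucc ≫ 𝟙 _ ≫ mor' i.succ
        simp)
    have e0 := hh 0
    change (mor 0 ≫ compChain n (fun i => obj i.succ) _) ≫ _ =
      h 0 ≫ mor' 0 ≫ compChain n (fun i => obj i.succ) _
    rw [Category.assoc]
    refine (congrArg (mor 0 ≫ ·) e).trans ?_
    rw [← Category.assoc, e0, Category.assoc]
    rfl

lemma HasUFP.exists_iso_of_decomp (hE : HasUFP E) {x y y' z : E} {u : x ⟶ y} {u' : x ⟶ y'}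
    (hu : Unfactorizable u) (hu' : Unfactorizable u') {w : y ⟶ z} {w' : y' ⟶ z}
    (D : Decomp w) (D' : Decomp w') (e : u ≫ w = u' ≫ w') (hf : ¬ IsIso (u ≫ w)) :
    ∃ h : y ≅ y', u ≫ h.hom = u' ∧ w = h.hom ≫ w' := by
  obtain ⟨n, obj, rfl, rfl, mor, unf, comp⟩ := D
  obtain ⟨n', obj', rfl, hl', mor', unf', comp'⟩ := D'
  obtain ⟨hn, hobj, h, hiso, h0, hl, hc⟩ := hE (u ≫ w) hf
    ⟨n + 1, Fin.cons (α := fun _ => E) x obj, rfl, rfl, Fin.cases u mor, Fin.cases hu unf, by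
      refine (compChain_cons n obj mor u).trans ?_
      change _ = 𝟙 _ ≫ (u ≫ w) ≫ 𝟙 _
      simp [comp]⟩
    ⟨n' + 1, Fin.cons (α := fun _ => E) x obj', rfl, hl', Fin.cases u' mor', Fin.cases hu' unf', by
      refine (compChain_cons n' obj' mor' u').trans ?_
      change _ = 𝟙 _ ≫ (u ≫ w) ≫ eqToHom hl'.symm
      simp [comp', e]⟩
  obtain rfl : n = n' := Nat.succ.inj hn
  obtain rfl : obj = obj' := funext fun i => hobj i.succ
  have hc0 := hc 0
  change u ≫ h (Fin.succ 0) = h 0 ≫ 𝟙 _ ≫ 𝟙 _ ≫ u' ≫ 𝟙 _ ≫ 𝟙 _ at hc0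
  have hlast : h (Fin.last n).succ = 𝟙 _ := hl
  have key := compChain_natural n obj mor mor' (fun i => h i.succ) fun i => by
    have := hc i.succ
    change mor i ≫ h i.succ.succ = h i.castSucc.succ ≫ 𝟙 _ ≫ 𝟙 _ ≫ mor' i ≫ 𝟙 _ ≫ 𝟙 _ at this
    simp only [Category.id_comp, Category.comp_id] at this
    exact this.trans (congrArg (h i.castSucc.succ ≫ ·) (Category.comp_id (mor' i)))
  have := hiso (Fin.succ 0)
  refine ⟨@asIso _ _ (obj 0) (obj 0) (h (Fin.succ 0)) this, ?_, ?_⟩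
  · change u ≫ h (Fin.succ 0) = u'
    rw [hc0, h0]
    change 𝟙 _ ≫ 𝟙 _ ≫ 𝟙 _ ≫ u' ≫ 𝟙 _ ≫ 𝟙 _ = u'
    simp
  · change w = h (Fin.succ 0) ≫ w'
    simp only [eqToHom_refl, Category.comp_id, Category.id_comp] at comp comp'
    rw [comp, comp'] at key
    change w ≫ h (Fin.last n).succ = h (Fin.succ 0) ≫ w' at key
    rw [hlast] at key
    exact (Category.comp_id w).symm.trans key

/-- Two factorizations of a morphism with unfactorizable first factor differ by an isomorphism. -/
lemma HasUFP.exists_iso (hE : HasUFP E)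
    (hD : ∀ {x y : E} (f : x ⟶ y), ¬ IsIso f → Nonempty (Decomp f))
    {x y y' z : E} {u : x ⟶ y} {u' : x ⟶ y'}
    (hu : Unfactorizable u) (hu' : Unfactorizable u') {w : y ⟶ z} {w' : y' ⟶ z}
    (e : u ≫ w = u' ≫ w') (hf : ¬ IsIso (u ≫ w)) :
    ∃ h : y ≅ y', u ≫ h.hom = u' ∧ w = h.hom ≫ w' := by
  have key : ∀ {y y' : E} {u : x ⟶ y} {u' : x ⟶ y'} (hu : Unfactorizable u)
      (hu' : Unfactorizable u') {w : y ⟶ z} {w' : y' ⟶ z} (e : u ≫ w = u' ≫ w'),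
      IsIso w' → IsIso w := by
    intro y y' u u' hu hu' w w' e hw'
    have : u ≫ (w ≫ inv w') = u' := by rw [← Category.assoc, e]; simp
    have := (hu'.2 _ _ _ this).resolve_left hu.1
    exact IsIso.of_isIso_comp_right w (inv w')
  by_cases hw : IsIso w
  · have hw' : IsIso w' := key hu' hu e.symm hw
    exact ⟨asIso w ≪≫ (asIso w').symm, by simp [reassoc_of% e], by simp⟩
  · have hw' : ¬ IsIso w' := fun h => hw (key hu hu' e h)
    obtain ⟨D⟩ := hD w hw
    obtain ⟨D'⟩ := hD w' hw'
    exact hE.exists_iso_of_decomp hu hu' D D' e hf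

/-- In an EI category, a morphism with a morphism in the opposite direction is invertible. -/
lemma isIso_of_reverse (hEnd : ∀ (x : E) (f : x ⟶ x), IsIso f) {x y : E} (f : x ⟶ y)
    (g : y ⟶ x) : IsIso f := by
  have h1 := hEnd _ (f ≫ g)
  have h2 := hEnd _ (g ≫ f)
  have : IsSplitMono f := ⟨⟨g ≫ inv (f ≫ g), by rw [← Category.assoc]; simp⟩⟩
  have : Epi f := (epi_of_epi g f)
  exact isIso_of_epi_of_isSplitMono f

lemma not_isIso_comp_right (hEnd : ∀ (x : E) (f : x ⟶ x), IsIso f) {x y z : E} (f : x ⟶ y)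
    (g : y ⟶ z) (hf : ¬ IsIso f) : ¬ IsIso (f ≫ g) := fun _ =>
  hf (isIso_of_reverse hEnd f (g ≫ inv (f ≫ g)))

/-- The objects between `x` and `y`. -/
def interval (x y : E) : Set E := {t | Nonempty (x ⟶ t) ∧ Nonempty (t ⟶ y)}

lemma ncard_interval_lt_left [Finite E] (hEnd : ∀ (x : E) (f : x ⟶ x), IsIso f) {x y z : E}
    (u : x ⟶ y) (v : y ⟶ z) (hv : ¬ IsIso v) :
    (interval x y).ncard < (interval x z).ncard := by
  refine Set.ncard_lt_ncard ⟨fun t ⟨⟨p⟩, ⟨q⟩⟩ => ⟨⟨p⟩, ⟨q ≫ v⟩⟩, fun h => ?_⟩ (Set.toFinite _)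
  obtain ⟨-, ⟨q⟩⟩ := h ⟨⟨u ≫ v⟩, ⟨𝟙 z⟩⟩
  exact hv (isIso_of_reverse hEnd v q)

lemma ncard_interval_lt_right [Finite E] (hEnd : ∀ (x : E) (f : x ⟶ x), IsIso f) {x y z : E}
    (u : x ⟶ y) (v : y ⟶ z) (hu : ¬ IsIso u) :
    (interval y z).ncard < (interval x z).ncard := by
  refine Set.ncard_lt_ncard ⟨fun t ⟨⟨p⟩, ⟨q⟩⟩ => ⟨⟨u ≫ p⟩, ⟨q⟩⟩, fun h => ?_⟩ (Set.toFinite _)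
  obtain ⟨⟨q⟩, -⟩ := h ⟨⟨𝟙 x⟩, ⟨u ≫ v⟩⟩
  exact hu (isIso_of_reverse hEnd u q)

lemma exists_unfactorizable_comp [Finite E] (hEnd : ∀ (x : E) (f : x ⟶ x), IsIso f) {x z : E}
    (f : x ⟶ z) (hf : ¬ IsIso f) :
    ∃ (y : E) (u : x ⟶ y) (w : y ⟶ z), Unfactorizable u ∧ u ≫ w = f := by
  induction hn : (interval x z).ncard using Nat.strong_induction_on generalizing z with
  | _ n ih =>
    by_cases h : Unfactorizable f
    · exact ⟨z, f, 𝟙 z, h, Category.comp_id f⟩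
    · simp only [Unfactorizable, not_and, not_forall, not_or] at h
      obtain ⟨y, u, v, rfl, hu, hv⟩ := h hf
      obtain ⟨t, u', w, hu', rfl⟩ :=
        ih _ (hn ▸ ncard_interval_lt_left hEnd u v hv) u hu rfl
      exact ⟨t, u', w ≫ v, hu', by simp⟩

lemma nonempty_decomp [Finite E] (hEnd : ∀ (x : E) (f : x ⟶ x), IsIso f) {x z : E}
    (f : x ⟶ z) (hf : ¬ IsIso f) : Nonempty (Decomp f) := by
  induction hn : (interval x z).ncard using Nat.strong_induction_on generalizing x with
  | _ n ih =>
    obtain ⟨y, u, w, hu, rfl⟩ := exists_unfactorizable_comp hEnd f hf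
    by_cases hw : IsIso w
    · have hu' : Unfactorizable (u ≫ w) := by
        refine ⟨hf, fun t p q hpq => ?_⟩
        have : p ≫ (q ≫ inv w) = u := by rw [← Category.assoc, hpq]; simp
        refine (hu.2 _ _ _ this).imp_right fun h => ?_
        have : IsIso (q ≫ inv w) := h
        exact IsIso.of_isIso_comp_right q (inv w)
      have D := Decomp.cons hu' (Decomp.id z)
      rw [Category.comp_id] at D
      exact ⟨D⟩
    · obtain ⟨D⟩ := ih _ (hn ▸ ncard_interval_lt_right hEnd u w hu.1) w hw rfl
      exact ⟨Decomp.cons hu D⟩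

end EICat

namespace EICat

section Lifting

variable {E : Type} [Category E] {k : Type} [Field k] {AA : Type} [Ring AA] [Algebra k AA]
  {b : (Σ x y : E, x ⟶ y) → AA}

/-- The left ideal generated by the noninvertible morphisms. -/
def nonisoIdeal (b : (Σ x y : E, x ⟶ y) → AA) : Ideal AA :=
  Submodule.span AA {a : AA | ∃ (x y : E) (f : x ⟶ y), ¬ IsIso f ∧ a = b ⟨x, y, f⟩}

lemma mem_nonisoIdeal (b : (Σ x y : E, x ⟶ y) → AA) {x y : E} (f : x ⟶ y) (hf : ¬ IsIso f) :
    b ⟨x, y, f⟩ ∈ nonisoIdeal b :=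
  Submodule.subset_span ⟨x, y, f, hf, rfl⟩

namespace IsCategoryAlgebra

lemma mul_comp (hb : IsCategoryAlgebra k AA b) {x y z : E} (f : x ⟶ y) (g : y ⟶ z) :
    b ⟨y, z, g⟩ * b ⟨x, y, f⟩ = b ⟨x, z, f ≫ g⟩ := by
  simp [hb.2.2.1]

lemma mul_eq_zero (hb : IsCategoryAlgebra k AA b) {x y z w : E} (f : x ⟶ y) (g : z ⟶ w)
    (h : y ≠ z) : b ⟨z, w, g⟩ * b ⟨x, y, f⟩ = 0 := by
  simp [hb.2.2.1, h]

/-- The basis of morphisms. -/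
noncomputable def basis (hb : IsCategoryAlgebra k AA b) : Module.Basis (Σ x y : E, x ⟶ y) k AA :=
  Module.Basis.mk hb.1 hb.2.1.ge

lemma basis_apply (hb : IsCategoryAlgebra k AA b) (p : Σ x y : E, x ⟶ y) : hb.basis p = b p := by
  simp [basis]

/-- A `k`-linear map which commutes with morphisms on noninvertible morphisms is `AA`-linear on
the ideal they generate. -/
lemma map_mul_of_mem (hb : IsCategoryAlgebra k AA b) {M : Type} [AddCommGroup M] [Module AA M]
    [Module k M] [IsScalarTower k AA M] (T : AA →ₗ[k] M)
    (hT : ∀ {x y z w : E} (f : x ⟶ y) (g : z ⟶ w), ¬ IsIso f →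
      T (b ⟨z, w, g⟩ * b ⟨x, y, f⟩) = b ⟨z, w, g⟩ • T (b ⟨x, y, f⟩))
    (a j : AA) (hj : j ∈ nonisoIdeal b) : T (a * j) = a • T j := by
  induction hj using Submodule.span_induction generalizing a with
  | mem j hj =>
    obtain ⟨x, y, f, hf, rfl⟩ := hj
    have ha : a ∈ Submodule.span k (Set.range b) := hb.2.1 ▸ Submodule.mem_top
    induction ha using Submodule.span_induction with
    | mem a ha => obtain ⟨⟨z, w, g⟩, rfl⟩ := ha; exact hT f g hf
    | zero => simp
    | add a a' _ _ h h' => rw [add_mul, map_add, h, h', add_smul]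
    | smul c a _ h => rw [smul_mul_assoc, map_smul, h, smul_assoc]
  | zero => simp
  | add j j' _ _ h h' => rw [mul_add, map_add, h, h', map_add, smul_add]
  | smul c j _ h => rw [smul_eq_mul, ← mul_assoc, h, h, mul_smul]

open scoped Classical in
/-- The sum of the coefficients of the identities. -/
noncomputable def idCoeff (hb : IsCategoryAlgebra k AA b) : AA →ₗ[k] k :=
  hb.basis.constr k fun p => if ∃ x : E, p = ⟨x, x, 𝟙 x⟩ then 1 else 0

open scoped Classical in
lemma idCoeff_apply (hb : IsCategoryAlgebra k AA b) (p : Σ x y : E, x ⟶ y) :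
    hb.idCoeff (b p) = if ∃ x : E, p = ⟨x, x, 𝟙 x⟩ then 1 else 0 := by
  rw [← hb.basis_apply, idCoeff, Module.Basis.constr_basis]

lemma idCoeff_id (hb : IsCategoryAlgebra k AA b) (x : E) :
    hb.idCoeff (b ⟨x, x, 𝟙 x⟩) = 1 := by
  rw [idCoeff_apply, if_pos ⟨x, rfl⟩]

lemma idCoeff_of_ne (hb : IsCategoryAlgebra k AA b) {x y : E} (f : x ⟶ y) (h : x ≠ y) :
    hb.idCoeff (b ⟨x, y, f⟩) = 0 := by
  rw [idCoeff_apply, if_neg]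
  rintro ⟨z, hz⟩
  cases hz
  exact h rfl

lemma idCoeff_endo (hb : IsCategoryAlgebra k AA b) {x : E} (f : x ⟶ x) (h : f ≠ 𝟙 x) :
    hb.idCoeff (b ⟨x, x, f⟩) = 0 := by
  rw [idCoeff_apply, if_neg]
  rintro ⟨z, hz⟩
  cases hz
  exact h rfl

lemma idCoeff_eq_zero_of_not_isIso (hb : IsCategoryAlgebra k AA b) {x y : E} (f : x ⟶ y)
    (h : ¬ IsIso f) : hb.idCoeff (b ⟨x, y, f⟩) = 0 := by
  rw [idCoeff_apply, if_neg]
  rintro ⟨z, hz⟩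
  cases hz
  exact h inferInstance

lemma idCoeff_eq_zero_of_mem (hEnd : ∀ (x : E) (f : x ⟶ x), IsIso f)
    (hb : IsCategoryAlgebra k AA b) (j : AA) (hj : j ∈ nonisoIdeal b) : hb.idCoeff j = 0 := by
  suffices ∀ a, hb.idCoeff (a * j) = 0 by simpa using this 1
  induction hj using Submodule.span_induction with
  | mem j hj =>
    obtain ⟨x, y, f, hf, rfl⟩ := hj
    intro a
    have ha : a ∈ Submodule.span k (Set.range b) := hb.2.1 ▸ Submodule.mem_top
    induction ha using Submodule.span_induction with
    | mem a ha =>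
      obtain ⟨⟨z, w, g⟩, rfl⟩ := ha
      by_cases h : y = z
      · subst h
        rw [hb.mul_comp]
        exact hb.idCoeff_eq_zero_of_not_isIso _ (not_isIso_comp_right hEnd f g hf)
      · rw [hb.mul_eq_zero f g h, map_zero]
    | zero => simp
    | add a a' _ _ h h' => rw [add_mul, map_add, h, h', add_zero]
    | smul c a _ h => rw [smul_mul_assoc, map_smul, h, smul_zero]
  | zero => simp
  | add j j' _ _ h h' => intro a; rw [mul_add, map_add, h, h', add_zero]
  | smul c j _ h => intro a; rw [smul_eq_mul, ← mul_assoc, h]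

/-- `idCoeff` on the degree zero quotient. -/
noncomputable def idCoeffQuot (hEnd : ∀ (x : E) (f : x ⟶ x), IsIso f)
    (hb : IsCategoryAlgebra k AA b) : (AA ⧸ nonisoIdeal b) →ₗ[k] k :=
  ((nonisoIdeal b).restrictScalars k).liftQ hb.idCoeff (hb.idCoeff_eq_zero_of_mem hEnd) ∘ₗ
    (Submodule.Quotient.restrictScalarsEquiv k (nonisoIdeal b)).symm.toLinearMap

lemma idCoeffQuot_mk (hEnd : ∀ (x : E) (f : x ⟶ x), IsIso f)
    (hb : IsCategoryAlgebra k AA b) (a : AA) :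
    hb.idCoeffQuot hEnd (Submodule.Quotient.mk a) = hb.idCoeff a := rfl

/-- The degree zero part of a finite category algebra is relatively injective: an embedding into
a module has a `k`-linear retraction which commutes with the invertible morphisms. -/
lemma exists_retraction [Finite E] [∀ x y : E, Finite (x ⟶ y)]
    (hEnd : ∀ (x : E) (f : x ⟶ x), IsIso f) (hb : IsCategoryAlgebra k AA b)
    {I : Type} [AddCommGroup I] [Module AA I] [Module k I] [IsScalarTower k AA I]
    (ι : (AA ⧸ nonisoIdeal b) →ₗ[AA] I) (hι : Function.Injective ι) :
    ∃ r : I →ₗ[k] (AA ⧸ nonisoIdeal b), (∀ n, r (ι n) = n) ∧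
      ∀ {y z : E} (g : y ≅ z) (v : I), r (b ⟨y, z, g.hom⟩ • v) = b ⟨y, z, g.hom⟩ • r v := by
  classical
  have := Fintype.ofFinite E
  have (x y : E) : Finite (x ≅ y) := Finite.of_injective Iso.hom fun _ _ h => Iso.ext h
  have (x y : E) : Fintype (x ≅ y) := Fintype.ofFinite _
  obtain ⟨q, hq⟩ := LinearMap.exists_leftInverse_of_injective (ι.restrictScalars k)
    (LinearMap.ker_eq_bot.2 hι)
  let μ : I →ₗ[k] k := hb.idCoeffQuot hEnd ∘ₗ q
  have hμ (n) : μ (ι n) = hb.idCoeffQuot hEnd n :=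
    congrArg (hb.idCoeffQuot hEnd) (LinearMap.congr_fun hq n)
  let r : I →ₗ[k] (AA ⧸ nonisoIdeal b) := ∑ x : E, ∑ y : E, ∑ h : x ≅ y,
    (μ ∘ₗ (Algebra.lsmul k k I (b ⟨y, x, h.inv⟩))).smulRight
      (Submodule.Quotient.mk (b ⟨x, y, h.hom⟩))
  have hr (v : I) : r v = ∑ x : E, ∑ y : E, ∑ h : x ≅ y,
      μ (b ⟨y, x, h.inv⟩ • v) • Submodule.Quotient.mk (b ⟨x, y, h.hom⟩) := by
    simp [r]
  refine ⟨r, fun n => ?_, fun {y z} g v => ?_⟩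
  · suffices H : r ∘ₗ ι.restrictScalars k ∘ₗ
        ((nonisoIdeal b).mkQ.restrictScalars k) = (nonisoIdeal b).mkQ.restrictScalars k by
      obtain ⟨a, rfl⟩ := Submodule.mkQ_surjective _ n
      exact LinearMap.congr_fun H a
    refine hb.basis.ext fun ⟨s, t, g⟩ => ?_
    rw [hb.basis_apply]
    change r (ι (Submodule.Quotient.mk (b ⟨s, t, g⟩))) = Submodule.Quotient.mk (b ⟨s, t, g⟩)
    by_cases hg : IsIso g
    · have hterm {x y : E} (h : x ≅ y) :
          μ (b ⟨y, x, h.inv⟩ • ι (Submodule.Quotient.mk (b ⟨s, t, g⟩))) =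
            hb.idCoeff (b ⟨y, x, h.inv⟩ * b ⟨s, t, g⟩) := by
        rw [← map_smul, hμ, ← Submodule.Quotient.mk_smul, idCoeffQuot_mk, smul_eq_mul]
      rw [hr, Finset.sum_eq_single s, Finset.sum_eq_single t, Finset.sum_eq_single (asIso g)]
      · rw [hterm, hb.mul_comp]
        simp [hb.idCoeff_id]
      · intro h _ hne
        rw [hterm, hb.mul_comp, hb.idCoeff_endo, zero_smul]
        intro h1
        refine hne (Iso.ext ?_)
        rw [asIso_hom, ← Category.id_comp h.hom, ← h1]
        simp
      · simp
      · intro y _ hy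
        refine Finset.sum_eq_zero fun h _ => ?_
        rw [hterm, hb.mul_eq_zero _ _ hy.symm, map_zero, zero_smul]
      · simp
      · intro x _ hx
        refine Finset.sum_eq_zero fun y _ => Finset.sum_eq_zero fun h _ => ?_
        rw [hterm]
        by_cases hy : t = y
        · subst hy
          rw [hb.mul_comp, hb.idCoeff_of_ne _ hx.symm, zero_smul]
        · rw [hb.mul_eq_zero _ _ hy, map_zero, zero_smul]
      · simp
    · rw [(Submodule.Quotient.mk_eq_zero _).2 (mem_nonisoIdeal b g hg), map_zero, map_zero]
  · rw [hr, hr, Finset.smul_sum]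
    refine Finset.sum_congr rfl fun x _ => ?_
    rw [Finset.sum_eq_single z, Finset.smul_sum, Finset.sum_eq_single y, Finset.smul_sum]
    · refine (Fintype.sum_equiv
        (⟨fun h => h ≪≫ g, fun h => h ≪≫ g.symm, fun h => by simp, fun h => by simp⟩ :
          (x ≅ y) ≃ (x ≅ z)) _ _ fun h => ?_).symm
      rw [smul_comm, ← Submodule.Quotient.mk_smul, smul_eq_mul, hb.mul_comp, smul_smul,
        hb.mul_comp]
      simp
    · intro t _ ht
      rw [Finset.smul_sum]
      refine Finset.sum_eq_zero fun h _ => ?_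
      rw [smul_comm, ← Submodule.Quotient.mk_smul, smul_eq_mul, hb.mul_eq_zero _ _ ht]
      simp
    · simp
    · intro t _ ht
      refine Finset.sum_eq_zero fun h _ => ?_
      rw [smul_smul, hb.mul_eq_zero _ _ ht.symm]
      simp
    · simp

/-- Maps out of the ideal of noninvertible morphisms lift along surjections with kernel
the degree zero quotient. -/
lemma exists_lift (hEI : IsFiniteFreeEI E) (hb : IsCategoryAlgebra k AA b)
    {I C : Type} [AddCommGroup I] [Module AA I] [AddCommGroup C] [Module AA C]
    (ι : (AA ⧸ nonisoIdeal b) →ₗ[AA] I) (hι : Function.Injective ι) (π : I →ₗ[AA] C)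
    (hπ : Function.Surjective π) (hex : Function.Exact ι π) (φ : nonisoIdeal b →ₗ[AA] C) :
    ∃ ψ : nonisoIdeal b →ₗ[AA] I, π ∘ₗ ψ = φ := by
  classical
  obtain ⟨_, _, hEnd, hU⟩ := hEI
  let _ : Module k I := Module.compHom I (algebraMap k AA)
  have : IsScalarTower k AA I := ⟨fun c a v => by
    rw [Algebra.smul_def, mul_smul]; rfl⟩
  obtain ⟨r, hrι, hrg⟩ := hb.exists_retraction hEnd ι hι
  let s : C → I := fun c => (hπ c).choose - ι (r (hπ c).choose)
  have hs (v : I) : s (π v) = v - ι (r v) := by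
    have h0 : π ((hπ (π v)).choose - v) = 0 := by rw [map_sub, (hπ (π v)).choose_spec, sub_self]
    obtain ⟨n, hn⟩ := (hex _).1 h0
    have h1 : (hπ (π v)).choose = v + ι n := by rw [hn]; abel
    simp only [s]
    rw [h1, map_add, map_add, hrι]
    abel
  have hπs (c : C) : π (s c) = c := by
    obtain ⟨v, rfl⟩ := hπ c
    rw [hs, map_sub, (hex _).2 ⟨_, rfl⟩, sub_zero]
  have hsg {y z : E} (g : y ≅ z) (c : C) : s (b ⟨y, z, g.hom⟩ • c) = b ⟨y, z, g.hom⟩ • s c := by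
    obtain ⟨v, rfl⟩ := hπ c
    rw [← map_smul, hs, hs, hrg, map_smul, smul_sub]
  choose mid u w hu huw using
    fun (x z : E) (f : x ⟶ z) (hf : ¬ IsIso f) => exists_unfactorizable_comp hEnd f hf
  let B {x y : E} (f : x ⟶ y) (hf : ¬ IsIso f) : nonisoIdeal b := ⟨_, mem_nonisoIdeal b f hf⟩
  let σ {x y : E} (f : x ⟶ y) (hf : ¬ IsIso f) : I := s (φ (B f hf))
  let T : AA →ₗ[k] I := hb.basis.constr k fun p =>
    if hf : ¬ IsIso p.2.2 then b ⟨_, _, w _ _ p.2.2 hf⟩ • σ (u _ _ p.2.2 hf) (hu _ _ p.2.2 hf).1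
    else 0
  have hT {x z : E} (f : x ⟶ z) (hf : ¬ IsIso f) :
      T (b ⟨x, z, f⟩) = b ⟨_, _, w _ _ f hf⟩ • σ (u _ _ f hf) (hu _ _ f hf).1 := by
    rw [← hb.basis_apply]
    simp only [T, Module.Basis.constr_basis]
    rw [dif_pos hf]
  have hT' {x y z : E} (u' : x ⟶ y) (w' : y ⟶ z) (hu' : Unfactorizable u') :
      T (b ⟨x, z, u' ≫ w'⟩) = b ⟨y, z, w'⟩ • σ u' hu'.1 := by
    have hf : ¬ IsIso (u' ≫ w') := not_isIso_comp_right hEnd _ _ hu'.1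
    obtain ⟨h, h1, h2⟩ := hU.exists_iso (fun f hf => nonempty_decomp hEnd f hf) hu'
      (hu _ _ _ hf) (huw _ _ _ hf).symm hf
    rw [hT _ hf]
    have : σ (u _ _ _ hf) (hu _ _ _ hf).1 = b ⟨_, _, h.hom⟩ • σ u' hu'.1 := by
      simp only [σ]
      rw [← hsg, ← map_smul]
      congr 2
      ext
      simp only [B, SetLike.mk_smul_mk, smul_eq_mul, hb.mul_comp, h1]
    rw [this, smul_smul, hb.mul_comp, ← h2]
  have hTlin := hb.map_mul_of_mem T fun {x y z t} f g hf => by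
    by_cases h : y = z
    · subst h
      rw [hb.mul_comp, hT f hf]
      conv_lhs => rw [← huw _ _ f hf, Category.assoc]
      rw [hT' _ _ (hu _ _ f hf), smul_smul, hb.mul_comp]
    · rw [hT f hf, smul_smul, hb.mul_eq_zero _ _ h, hb.mul_eq_zero _ _ h, map_zero, zero_smul]
  let ψ : nonisoIdeal b →ₗ[AA] I :=
    { toFun := fun j => T j
      map_add' := fun _ _ => map_add T _ _
      map_smul' := fun a j => hTlin a j j.2 }
  refine ⟨ψ, ?_⟩
  refine LinearMap.ext fun ⟨j, hj⟩ => ?_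
  change π (T j) = _
  induction hj using Submodule.span_induction with
  | mem j hj =>
    obtain ⟨x, y, f, hf, rfl⟩ := hj
    rw [hT f hf, map_smul, hπs, ← map_smul]
    congr 1
    ext
    simp only [B, SetLike.mk_smul_mk, smul_eq_mul, hb.mul_comp, huw]
  | zero =>
    rw [map_zero, map_zero]
    exact (map_zero φ).symm
  | add j j' hj hj' h h' =>
    rw [map_add, map_add, h, h', ← map_add]
    rfl
  | smul a j hj h =>
    change π (T (a * j)) = _
    rw [hTlin a j hj, map_smul, h, ← map_smul]
    rfl

end IsCategoryAlgebra

end Lifting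

end EICat

/-- `Ext²(R ⧸ J, N)` vanishes if maps out of `J` lift along surjections with kernel `N`. -/
lemma ModuleCat.subsingleton_ext_two_quotient {R : Type} [Ring R] [HasExt.{0} (ModuleCat.{0} R)]
    (J : Ideal R) (N : Type) [AddCommGroup N] [Module R N]
    (h : ∀ (I C : Type) [AddCommGroup I] [Module R I] [AddCommGroup C] [Module R C]
      (ι : N →ₗ[R] I) (π : I →ₗ[R] C), Function.Injective ι → Function.Surjective π →
      Function.Exact ι π → ∀ φ : J →ₗ[R] C, ∃ ψ : J →ₗ[R] I, π ∘ₗ ψ = φ) :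
    Subsingleton (Abelian.Ext (ModuleCat.of R (R ⧸ J)) (ModuleCat.of R N) 2) := by
  refine subsingleton_of_forall_eq 0 fun e => ?_
  have hS := ModuleCat.shortComplex_shortExact
    (ModuleCat.shortComplexOfCompEqZero J.subtype J.mkQ (by ext; simp))
    (LinearMap.exact_subtype_mkQ J) J.subtype_injective J.mkQ_surjective
  have : Projective (ModuleCat.of R R) :=
    (IsProjective.iff_projective R).1 inferInstance
  obtain ⟨e₁, rfl⟩ := Abelian.Ext.contravariant_sequence_exact₃ hS _ e
    (@Abelian.Ext.eq_zero_of_projective _ _ _ _ _ _ _ this _) (add_comm 1 1)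
  let j := Injective.ι (ModuleCat.of R N)
  have hj : Function.Injective j.hom := (ModuleCat.mono_iff_injective j).1 inferInstance
  have hex : Function.Exact j.hom (LinearMap.range j.hom).mkQ := LinearMap.exact_map_mkQ_range _
  have hT := ModuleCat.shortComplex_shortExact
    (ModuleCat.shortComplexOfCompEqZero j.hom (LinearMap.range j.hom).mkQ
      hex.linearMap_comp_eq_zero) hex hj (Submodule.mkQ_surjective _)
  obtain ⟨e₀, rfl⟩ := Abelian.Ext.covariant_sequence_exact₁ _ hT e₁
    (@Abelian.Ext.eq_zero_of_injective _ _ _ _ _ _ _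
      (inferInstanceAs (Injective (Injective.under (ModuleCat.of R N)))) _) (zero_add 1)
  obtain ⟨φ, rfl⟩ := (Abelian.Ext.mk₀_bijective _ _).2 e₀
  obtain ⟨ψ, hψ⟩ := h _ _ j.hom _ hj (Submodule.mkQ_surjective _) hex φ.hom
  have hφ : φ = ModuleCat.ofHom ψ ≫ ModuleCat.ofHom (LinearMap.range j.hom).mkQ :=
    ModuleCat.hom_ext hψ.symm
  have hz : (Abelian.Ext.mk₀ φ).comp hT.extClass (zero_add 1) = 0 := by
    rw [hφ, ← Abelian.Ext.mk₀_comp_mk₀, Abelian.Ext.comp_assoc_of_second_deg_zero]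
    erw [hT.comp_extClass, Abelian.Ext.comp_zero]
  rw [hz, Abelian.Ext.comp_zero]

open EICat CategoryTheory in
/-- let `E` be a finite free EI category with category algebra `kE`.
Then `Ext²_{kE}(kE₀, kE₀) = 0`, where `kE₀ = ⊕ₓ k Aut_E(x)` is the span of all
isomorphisms, viewed as a `kE`-module via the quotient `kE → kE₀ = kE/J`, `J` being
the (two-sided) ideal spanned by all non-isomorphisms. -/
theorem stmt19 (k : Type) [Field k] (E : Type) [Category E]
    (hEI : IsFiniteFreeEI E)
    (AA : Type) [Ring AA] [Algebra k AA]
    [HasExt.{0} (ModuleCat.{0} AA)]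
    (b : (Σ x y : E, x ⟶ y) → AA)
    (hb : IsCategoryAlgebra k AA b)
    (J : Ideal AA)
    (hJ : J = Submodule.span AA
      {a : AA | ∃ (x y : E) (f : x ⟶ y), ¬ IsIso f ∧ a = b ⟨x, y, f⟩}) :
    Subsingleton
      (Abelian.Ext (ModuleCat.of AA (AA ⧸ J)) (ModuleCat.of AA (AA ⧸ J)) 2) := by
  subst hJ
  exact ModuleCat.subsingleton_ext_two_quotient (nonisoIdeal b) _
    fun I C _ _ _ _ ι π hι hπ hex φ => hb.exists_lift hEI ι hι π hπ hex φ
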